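/- Let K be a field of characteristic zero and let h ≤ k be natural numbers. Let P_k be the generic Pfaffian in the variables z_{ij} (0 ≤ i < j ≤ 2k+1). Then: (a) for every (2k+2)×(2k+2) alternating matrix Z over K with rank(Z) ≤ 2h, every iterated partial derivative of P_k of order at most k−h evaluates to 0 at the point (Z_{ij})_{i<j}; and (b) for every (2k+2)×(2k+2) alternating matrix Z over K with rank(Z) = 2h, there exists an iterated partial derivative of P_k of order exactly k−h+1 whose evaluation at (Z_{ij})_{i<j} is nonzero. In other words, P_k vanishes to order exactly k−h+1 at every alternating matrix of rank exactly 2h. -/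

import Mathlib

open Matrix

/-- The Pfaffian of a matrix (intended for `2m×2m` alternating matrices, with `m = n/2`):
`pf Z = (1/(2^m · m!)) · ∑_{σ ∈ Sym(2m)} sgn(σ) · ∏_{i=1}^{m} Z_{σ(2i−1), σ(2i)}`
(written with 0-based indices). The Pfaffian of the empty matrix is `1`. -/
noncomputable def pf {R : Type*} [CommRing R] [Algebra ℚ R] {n : ℕ}
    (Z : Matrix (Fin n) (Fin n) R) : R :=
  ((2 ^ (n / 2) * Nat.factorial (n / 2) : ℚ))⁻¹ •
    ∑ σ : Equiv.Perm (Fin n), ((Equiv.Perm.sign σ : ℤ) : R) *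
      ∏ i : Fin (n / 2),
        Z (σ ⟨2 * i, by have := i.isLt; omega⟩) (σ ⟨2 * i + 1, by have := i.isLt; omega⟩)

/-- The generic `n×n` alternating matrix, whose `(i,j)` entry is the variable `z_{ij}`
for `i < j`, `−z_{ji}` for `i > j`, and `0` for `i = j`. -/
noncomputable def genMat (K : Type*) [Field K] (n : ℕ) :
    Matrix (Fin n) (Fin n) (MvPolynomial {p : Fin n × Fin n // p.1 < p.2} K) :=
  Matrix.of fun i j =>
    if h : i < j then MvPolynomial.X ⟨(i, j), h⟩
    else if h' : j < i then - MvPolynomial.X ⟨(j, i), h'⟩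
    else 0

/-- The iterated partial derivative of a multivariate polynomial with respect to a list of
variables; the order of the derivative is the length of the list. -/
noncomputable def iterDeriv {σ : Type*} {K : Type*} [CommSemiring K]
    (l : List σ) (p : MvPolynomial σ K) : MvPolynomial σ K :=
  l.foldr (fun v q => MvPolynomial.pderiv v q) p

section PairSum

theorem eq_of_perm_fst_eq {κ : Type*} {σ : Equiv.Perm (κ × Fin 2)} {i j : κ}
    (hi : (σ (i, 0)).1 = (σ (i, 1)).1) (hj : (σ (i, 0)).1 = (σ (j, 0)).1) : i = j := by
  have hne : (σ (i, 0)).2 ≠ (σ (i, 1)).2 := fun h => by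
    simpa using σ.injective (Prod.ext hi h)
  rcases (by omega : (σ (j, 0)).2 = (σ (i, 0)).2 ∨ (σ (j, 0)).2 = (σ (i, 1)).2) with h | h
  · exact congrArg Prod.fst (σ.injective (Prod.ext hj h.symm))
  · exact congrArg Prod.fst (σ.injective (Prod.ext (hi.symm.trans hj) h.symm))

variable {R S κ : Type*} [CommRing R] [CommRing S] [DecidableEq κ]

/-- The block diagonal alternating matrix with `2×2` blocks `!![0, d i; -d i, 0]`. -/
def altBlock (d : κ → R) : Matrix (κ × Fin 2) (κ × Fin 2) R :=
  Matrix.of fun x y => if x.1 = y.1 then d x.1 * (!![0, 1; -1, 0] : Matrix _ _ R) x.2 y.2 else 0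

theorem altBlock_apply (d : κ → R) (x y : κ × Fin 2) : altBlock d x y =
    if x.1 = y.1 then d x.1 * (!![0, 1; -1, 0] : Matrix _ _ R) x.2 y.2 else 0 := rfl

theorem altBlock_transpose (d : κ → R) : (altBlock d)ᵀ = -altBlock d := by
  ext ⟨i, a⟩ ⟨j, b⟩
  rw [Matrix.transpose_apply, Matrix.neg_apply, altBlock_apply, altBlock_apply]
  by_cases hij : i = j
  · subst hij
    fin_cases a <;> fin_cases b <;> simp
  · simp [hij, Ne.symm hij]

theorem altBlock_one_map (f : R →+* S) : (altBlock (1 : κ → R)).map f = altBlock 1 := by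
  ext ⟨i, a⟩ ⟨j, b⟩
  rw [Matrix.map_apply, altBlock_apply, altBlock_apply]
  by_cases hij : i = j
  · fin_cases a <;> fin_cases b <;> simp [hij]
  · simp [hij]

variable [Fintype κ]

/-- The unnormalised Pfaffian of a matrix whose index set is grouped into pairs. -/
def pfSum (Z : Matrix (κ × Fin 2) (κ × Fin 2) R) : R :=
  ∑ σ : Equiv.Perm (κ × Fin 2), ((Equiv.Perm.sign σ : ℤ) : R) * ∏ i, Z (σ (i, 0)) (σ (i, 1))

theorem map_pfSum (f : R →+* S) (Z : Matrix (κ × Fin 2) (κ × Fin 2) R) :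
    f (pfSum Z) = pfSum (Z.map f) := by
  simp [pfSum, map_sum, map_prod]

theorem pfSum_mul_mul_transpose_expand (A Z : Matrix (κ × Fin 2) (κ × Fin 2) R) :
    pfSum (A * Z * Aᵀ) = ∑ f : κ → (κ × Fin 2) × (κ × Fin 2),
      (∏ i, Z (f i).1 (f i).2) *
        (A.submatrix id fun x => if x.2 = 0 then (f x.1).1 else (f x.1).2).det := by
  have entry : ∀ x y, (A * Z * Aᵀ) x y =
      ∑ p : (κ × Fin 2) × (κ × Fin 2), Z p.1 p.2 * (A x p.1 * A y p.2) := by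
    intro x y
    simp only [Matrix.mul_apply, Matrix.transpose_apply, Finset.sum_mul]
    refine Eq.trans ?_ (Fintype.sum_prod_type_right _).symm
    refine Fintype.sum_congr _ _ fun p => Fintype.sum_congr _ _ fun q => ?_
    ring
  simp only [pfSum, entry, Finset.prod_univ_sum, Matrix.det_apply', Finset.mul_sum,
    Fintype.piFinset_univ]
  rw [Finset.sum_comm]
  refine Fintype.sum_congr _ _ fun f => Fintype.sum_congr _ _ fun σ => ?_
  simp only [Fintype.prod_prod_type, Fin.prod_univ_two, Matrix.submatrix_apply, id,
    Finset.prod_mul_distrib]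
  simp
  ring

theorem pfSum_mul_mul_transpose (A Z : Matrix (κ × Fin 2) (κ × Fin 2) R) :
    pfSum (A * Z * Aᵀ) = A.det * pfSum Z := by
  have det_sub : ∀ g : κ × Fin 2 → κ × Fin 2, (A.submatrix id g).det =
      A.det * ((1 : Matrix (κ × Fin 2) (κ × Fin 2) R).submatrix id g).det := by
    intro g
    rw [← Matrix.det_mul]
    congr 1
    ext x y
    simp [Matrix.mul_apply, Matrix.one_apply]
  have hZ := pfSum_mul_mul_transpose_expand 1 Z
  rw [Matrix.one_mul, Matrix.transpose_one, Matrix.mul_one] at hZ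
  rw [pfSum_mul_mul_transpose_expand, hZ, Finset.mul_sum]
  refine Fintype.sum_congr _ _ fun f => ?_
  rw [det_sub]
  ring

theorem pfSum_altBlock (d : κ → R) :
    pfSum (altBlock d) = (∏ i, d i) * pfSum (altBlock (1 : κ → R)) := by
  have key : altBlock d = Matrix.diagonal (fun x : κ × Fin 2 => if x.2 = 0 then d x.1 else 1) *
      altBlock (1 : κ → R) *
        (Matrix.diagonal (fun x : κ × Fin 2 => if x.2 = 0 then d x.1 else 1))ᵀ := by
    ext ⟨i, a⟩ ⟨j, b⟩
    rw [Matrix.diagonal_transpose, Matrix.mul_diagonal, Matrix.diagonal_mul, altBlock_apply,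
      altBlock_apply]
    by_cases hij : i = j
    · subst hij
      fin_cases a <;> fin_cases b <;> simp
    · simp [hij]
  rw [key, pfSum_mul_mul_transpose, Matrix.det_diagonal]
  simp [Fintype.prod_prod_type]

theorem pfSum_altBlock_one_term_nonneg (σ : Equiv.Perm (κ × Fin 2)) :
    0 ≤ (Equiv.Perm.sign σ : ℤ) *
      ∏ i, altBlock (1 : κ → ℤ) (σ (i, 0)) (σ (i, 1)) := by
  by_cases hσ : ∀ i, (σ (i, 0)).1 = (σ (i, 1)).1
  · have hinj : Function.Injective fun i => (σ (i, 0)).1 := fun i j h => eq_of_perm_fst_eq (hσ i) h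
    let ρ : Equiv.Perm κ := Equiv.ofBijective _ (Finite.injective_iff_bijective.1 hinj)
    let τ : κ → Equiv.Perm (Fin 2) := fun i => if (σ (i, 0)).2 = 0 then 1 else Equiv.swap 0 1
    have hne : ∀ i, (σ (i, 0)).2 ≠ (σ (i, 1)).2 := fun i h => by
      simpa using σ.injective (Prod.ext (hσ i) h)
    have hfac : σ = Equiv.prodCongrLeft (fun _ => ρ) * Equiv.prodCongrRight τ := by
      ext ⟨i, a⟩ : 1
      have := hne i
      refine Prod.ext ?_ ?_
      · fin_cases a
        · simp [ρ]
        · simp [ρ, hσ]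
      · rcases (by omega : (σ (i, 0)).2 = 0 ∨ (σ (i, 0)).2 = 1) with h | h
        · have h1 : (σ (i, 1)).2 = 1 := by omega
          fin_cases a <;> simp [τ, h, h1]
        · have h1 : (σ (i, 1)).2 = 0 := by omega
          fin_cases a <;> simp [τ, h, h1]
    have hentry : ∀ i, altBlock (1 : κ → ℤ) (σ (i, 0)) (σ (i, 1)) = Equiv.Perm.sign (τ i) := by
      intro i
      have := hne i
      rw [altBlock_apply, if_pos (hσ i)]
      rcases (by omega : (σ (i, 0)).2 = 0 ∨ (σ (i, 0)).2 = 1) with h | h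
      · have h1 : (σ (i, 1)).2 = 1 := by omega
        simp [τ, h, h1]
      · have h1 : (σ (i, 1)).2 = 0 := by omega
        simp [τ, h, h1]
    have hsign : (Equiv.Perm.sign σ : ℤ) = ∏ i, (Equiv.Perm.sign (τ i) : ℤ) := by
      rw [hfac, Equiv.Perm.sign_mul, Equiv.Perm.sign_prodCongrLeft, Equiv.Perm.sign_prodCongrRight]
      simp
    simp only [hentry, hsign]
    exact mul_self_nonneg _
  · push Not at hσ
    obtain ⟨i, hi⟩ := hσ
    rw [Finset.prod_eq_zero (Finset.mem_univ i) (by rw [altBlock_apply, if_neg hi]), mul_zero]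

theorem pfSum_altBlock_one_pos : 0 < pfSum (altBlock (1 : κ → ℤ)) := by
  refine Finset.sum_pos' (fun σ _ => by simpa using pfSum_altBlock_one_term_nonneg σ)
    ⟨1, Finset.mem_univ _, ?_⟩
  simp [altBlock_apply]

theorem pfSum_altBlock_one_ne_zero [CharZero R] : pfSum (altBlock (1 : κ → R)) ≠ 0 := by
  rw [← altBlock_one_map (Int.castRingHom R), ← map_pfSum]
  simpa using pfSum_altBlock_one_pos.ne'

theorem pfSum_mem_pow (I : Ideal R) (s : Finset κ) (Z : Matrix (κ × Fin 2) (κ × Fin 2) R)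
    (hZ : ∀ x y, ¬ (x.1 = y.1 ∧ x.1 ∈ s) → Z x y ∈ I) :
    pfSum Z ∈ I ^ (Fintype.card κ - s.card) := by
  refine Ideal.sum_mem _ fun σ _ => Ideal.mul_mem_left _ _ ?_
  let t : Finset κ := {i | (σ (i, 0)).1 = (σ (i, 1)).1 ∧ (σ (i, 0)).1 ∈ s}
  have ht : t.card ≤ s.card :=
    Finset.card_le_card_of_injOn (fun i => (σ (i, 0)).1) 
      (fun i hi => by simpa using (Finset.mem_filter.1 hi).2.2)
      fun i hi j _ h => eq_of_perm_fst_eq (Finset.mem_filter.1 hi).2.1 h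
  rw [← Finset.prod_mul_prod_compl t]
  refine Ideal.mul_mem_left _ _ (Ideal.pow_le_pow_right
    (n := tᶜ.card) (by rw [Finset.card_compl]; omega) ?_)
  rw [← Finset.prod_const]
  exact Ideal.prod_mem_prod fun i hi => hZ _ _ (by simpa [t] using hi)

end PairSum

section Darboux

variable {K : Type*} [Field K]

theorem exists_darboux_basis (m : ℕ) : ∀ {V : Type*} [AddCommGroup V] [Module K V]
    [FiniteDimensional K V] (B : LinearMap.BilinForm K V), B.IsAlt → Module.finrank K V = m * 2 →
    ∃ (s : Finset (Fin m)) (b : Module.Basis (Fin m × Fin 2) K V),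
      ∀ x y, B (b x) (b y) = altBlock (fun i => if i ∈ s then (1 : K) else 0) x y := by
  induction m with
  | zero =>
    intro V _ _ _ B hB hV
    exact ⟨∅, Module.Basis.reindex (Module.finBasisOfFinrankEq K V hV) finProdFinEquiv.symm,
      fun x => x.1.elim0⟩
  | succ m ih =>
    intro V _ _ _ B hB hV
    by_cases hB0 : B = 0
    · refine ⟨∅, Module.Basis.reindex (Module.finBasisOfFinrankEq K V hV) finProdFinEquiv.symm,
        fun x y => ?_⟩
      simp [hB0, altBlock_apply]
    obtain ⟨e, f, hef⟩ : ∃ e f, B e f = 1 := by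
      have : ∃ e f, B e f ≠ 0 := by
        by_contra! h
        exact hB0 (LinearMap.ext₂ h)
      obtain ⟨e, f, h⟩ := this
      exact ⟨e, (B e f)⁻¹ • f, by simp [h]⟩
    have hfe : B f e = -1 := by rw [← hB.neg_eq, hef]
    let L : V →ₗ[K] K × K := (B e).prod (B f)
    have hL : Function.Surjective L := by
      rintro ⟨a, b⟩
      exact ⟨a • f - b • e, by simp [L, hef, hfe, hB.self_eq_zero]⟩
    have hker : Module.finrank K (LinearMap.ker L) = m * 2 := by
      have h := LinearMap.finrank_range_add_finrank_ker L
      rw [LinearMap.range_eq_top.2 hL, finrank_top, Module.finrank_prod, Module.finrank_self] at h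
      omega
    obtain ⟨s, b, hb⟩ := ih (B.restrict (LinearMap.ker L)) (fun x => hB x) hker
    have hbe : ∀ x, B e (b x) = 0 := fun x => congrArg Prod.fst (b x).2
    have hbf : ∀ x, B f (b x) = 0 := fun x => congrArg Prod.snd (b x).2
    let v : Fin (m + 1) × Fin 2 → V := fun x =>
      Fin.cases (if x.2 = 0 then e else f) (fun i => (b (i, x.2) : V)) x.1
    have hspan : ⊤ ≤ Submodule.span K (Set.range v) := by
      intro x _
      have he : e ∈ Submodule.span K (Set.range v) := Submodule.subset_span ⟨(0, 0), by simp [v]⟩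
      have hf : f ∈ Submodule.span K (Set.range v) := Submodule.subset_span ⟨(0, 1), by simp [v]⟩
      have hW : LinearMap.ker L ≤ Submodule.span K (Set.range v) := by
        have h := congrArg (Submodule.map (LinearMap.ker L).subtype) b.span_eq
        rw [Submodule.map_span, Submodule.map_subtype_top] at h
        rw [← h]
        refine Submodule.span_mono ?_
        rintro _ ⟨_, ⟨⟨i, a⟩, rfl⟩, rfl⟩
        exact ⟨(i.succ, a), by simp [v]⟩
      have hx : x = (B e x • f - B f x • e) + (x - (B e x • f - B f x • e)) := by abel
      rw [hx]
      refine add_mem (sub_mem (Submodule.smul_mem _ _ hf) (Submodule.smul_mem _ _ he)) (hW ?_)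
      simp [L, hef, hfe, hB.self_eq_zero]
    let c := basisOfTopLeSpanOfCardEqFinrank v hspan (by simp [hV])
    refine ⟨insert 0 (s.map (Fin.succEmb m)), c, ?_⟩
    have hc : ⇑c = v := coe_basisOfTopLeSpanOfCardEqFinrank ..
    have hbe' : ∀ x, B (b x) e = 0 := fun x => by rw [← hB.neg_eq, hbe, neg_zero]
    have hbf' : ∀ x, B (b x) f = 0 := fun x => by rw [← hB.neg_eq, hbf, neg_zero]
    rintro ⟨i, a⟩ ⟨j, a'⟩
    rw [hc, altBlock_apply]
    cases i using Fin.cases with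
    | zero =>
      cases j using Fin.cases with
      | zero => fin_cases a <;> fin_cases a' <;> simp [v, hef, hfe, hB.self_eq_zero]
      | succ j => fin_cases a <;> simp [v, hbe, hbf, (Fin.succ_ne_zero j).symm]
    | succ i =>
      cases j using Fin.cases with
      | zero => fin_cases a' <;> simp [v, hbe', hbf', Fin.succ_ne_zero i]
      | succ j =>
        have h := hb (i, a) (j, a')
        rw [altBlock_apply] at h
        simpa [v, Fin.succ_ne_zero] using h

open Classical in
theorem rank_altBlock_indicator {κ : Type*} [Fintype κ] [DecidableEq κ] (s : Finset κ) :
    (altBlock (fun i => if i ∈ s then (1 : K) else 0)).rank = 2 * s.card := by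
  set J := altBlock (fun i => if i ∈ s then (1 : K) else 0) with hJ
  let w : κ × Fin 2 → K := fun x => if x.1 ∈ s then -1 else 0
  have hsq : J * J = Matrix.diagonal w := by
    ext ⟨i, a⟩ ⟨j, b⟩
    simp only [hJ, Matrix.mul_apply, altBlock_apply, Fintype.sum_prod_type, Fin.sum_univ_two]
    rw [Finset.sum_eq_single i (by intro l _ hl; simp [hl.symm]) (by simp)]
    by_cases hij : i = j
    · subst hij
      by_cases hs : i ∈ s <;> fin_cases a <;> fin_cases b <;> simp [w, hs]
    · simp [hij]
  have hmul : J * Matrix.diagonal w = -J := by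
    ext ⟨i, a⟩ ⟨j, b⟩
    rw [Matrix.mul_diagonal, Matrix.neg_apply, hJ, altBlock_apply]
    by_cases hij : i = j
    · subst hij
      by_cases hs : i ∈ s <;> simp [w, hs]
    · simp [hij]
  have hrank : (Matrix.diagonal w).rank = 2 * s.card := by
    rw [Matrix.rank_diagonal, Fintype.card_subtype]
    have : (Finset.univ.filter fun x : κ × Fin 2 => w x ≠ 0) = s ×ˢ Finset.univ := by
      ext x
      simp [w]
    rw [this, Finset.card_product, Finset.card_univ, Fintype.card_fin, mul_comm]
  refine le_antisymm ?_ ?_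
  · have h : J = -J * Matrix.diagonal w := by rw [Matrix.neg_mul, hmul, neg_neg]
    rw [← hrank, h]
    exact Matrix.rank_mul_le_right _ _
  · rw [← hrank, ← hsq]
    exact Matrix.rank_mul_le_left _ _

theorem exists_congruent_altBlock [CharZero K] {m : ℕ} (Z : Matrix (Fin m × Fin 2) (Fin m × Fin 2) K)
    (hZ : Zᵀ = -Z) :
    ∃ (s : Finset (Fin m)) (A : Matrix (Fin m × Fin 2) (Fin m × Fin 2) K), IsUnit A.det ∧
      Z = A * altBlock (fun i => if i ∈ s then (1 : K) else 0) * Aᵀ ∧ Z.rank = 2 * s.card := by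
  let B := Matrix.toBilin' Z
  have hB : B.IsAlt := by
    intro x
    have h : x ⬝ᵥ Z *ᵥ x = -(x ⬝ᵥ Z *ᵥ x) := by
      rw [← dotProduct_neg, ← Matrix.neg_mulVec, ← hZ, Matrix.mulVec_transpose,
        Matrix.dotProduct_mulVec, dotProduct_comm]
    rw [Matrix.toBilin'_apply']
    exact self_eq_neg.1 h
  obtain ⟨s, b, hb⟩ := exists_darboux_basis m B hB (by simp)
  let P := (Pi.basisFun K (Fin m × Fin 2)).toMatrix b
  have hP : IsUnit P.det := by
    rw [← Matrix.isUnit_iff_isUnit_det]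
    have := Module.Basis.invertibleToMatrix (Pi.basisFun K (Fin m × Fin 2)) b
    exact isUnit_of_invertible P
  have hJ : altBlock (fun i => if i ∈ s then (1 : K) else 0) = Pᵀ * Z * P := by
    ext x y
    rw [← hb, Matrix.toBilin'_apply', Matrix.mul_mul_apply]
    rfl
  have hZJ : Z = P⁻¹ᵀ * altBlock (fun i => if i ∈ s then (1 : K) else 0) * P⁻¹ᵀᵀ := by
    rw [hJ, Matrix.transpose_transpose, Matrix.mul_assoc, Matrix.mul_nonsing_inv_cancel_right _ _ hP,
      ← Matrix.mul_assoc, ← Matrix.transpose_mul, Matrix.mul_nonsing_inv _ hP,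
      Matrix.transpose_one, Matrix.one_mul]
  refine ⟨s, P⁻¹ᵀ, by simpa using hP, hZJ, ?_⟩
  rw [← rank_altBlock_indicator (K := K) s, hJ, Matrix.rank_mul_eq_left_of_isUnit_det _ _ hP,
    Matrix.rank_mul_eq_right_of_isUnit_det _ _ (by simpa using hP)]

end Darboux

section Derivatives

variable {σ K : Type*}

theorem pderiv_mem_pow [CommRing K] (I : Ideal (MvPolynomial σ K)) (v : σ) (n : ℕ) :
    ∀ p ∈ I ^ (n + 1), MvPolynomial.pderiv v p ∈ I ^ n := by
  induction n with
  | zero => simp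
  | succ n ih =>
    intro p hp
    rw [pow_succ'] at hp
    refine Submodule.mul_induction_on hp (fun a ha b hb => ?_) fun a b ha hb => ?_
    · rw [Derivation.leibniz, smul_eq_mul, smul_eq_mul]
      refine add_mem ?_ (Ideal.mul_mem_right _ _ hb)
      rw [pow_succ']
      exact Ideal.mul_mem_mul ha (ih b hb)
    · rw [map_add]
      exact add_mem ha hb

theorem iterDeriv_mem_pow [CommRing K] (I : Ideal (MvPolynomial σ K)) (n : ℕ) (l : List σ)
    {p : MvPolynomial σ K} (hp : p ∈ I ^ (n + l.length)) : iterDeriv l p ∈ I ^ n := by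
  induction l generalizing n with
  | nil => simpa [iterDeriv] using hp
  | cons v l ih =>
    refine pderiv_mem_pow I v n _ (ih (n + 1) ?_)
    rwa [List.length_cons, ← add_assoc, add_right_comm] at hp

/-- Restriction of a polynomial to the line through `z` with direction `w`. -/
noncomputable def restrictLine [CommRing K] (z w : σ → K) :
    MvPolynomial σ K →ₐ[K] Polynomial K :=
  MvPolynomial.aeval fun v => Polynomial.C (z v) + Polynomial.X * Polynomial.C (w v)

theorem eval_zero_restrictLine [CommRing K] (z w : σ → K) (p : MvPolynomial σ K) :
    (restrictLine z w p).eval 0 = MvPolynomial.eval z p := by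
  induction p using MvPolynomial.induction_on with
  | C a => simp [restrictLine]
  | add p q hp hq => simp [hp, hq]
  | mul_X p v hp => rw [map_mul, Polynomial.eval_mul, hp]; simp [restrictLine]

theorem derivative_restrictLine [CommRing K] [Fintype σ] (z w : σ → K) (p : MvPolynomial σ K) :
    Polynomial.derivative (restrictLine z w p) =
      ∑ v, Polynomial.C (w v) * restrictLine z w (MvPolynomial.pderiv v p) := by
  classical
  induction p using MvPolynomial.induction_on with
  | C a => simp [restrictLine]
  | add p q hp hq => simp [hp, hq, mul_add, Finset.sum_add_distrib]
  | mul_X p v hp =>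
    have hX : restrictLine z w (MvPolynomial.X v) =
        Polynomial.C (z v) + Polynomial.X * Polynomial.C (w v) := by simp [restrictLine]
    simp only [map_mul, Polynomial.derivative_mul, hp, Derivation.leibniz, smul_eq_mul, map_add,
      mul_add, Finset.sum_add_distrib, Finset.sum_mul, MvPolynomial.pderiv_X]
    rw [add_comm]
    congr 1
    · rw [Finset.sum_eq_single v (by intro u _ hu; simp [hu]) (by simp)]
      simp [hX]
      ring
    · refine Finset.sum_congr rfl fun u _ => ?_
      ring

theorem eval_iterate_derivative_restrictLine_eq_zero [CommRing K] [Fintype σ] (z w : σ → K)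
    (n : ℕ) : ∀ p : MvPolynomial σ K,
      (∀ l : List σ, l.length = n → MvPolynomial.eval z (iterDeriv l p) = 0) →
      (Polynomial.derivative^[n] (restrictLine z w p)).eval 0 = 0 := by
  induction n with
  | zero =>
    intro p hp
    simpa [eval_zero_restrictLine, iterDeriv] using hp [] rfl
  | succ n ih =>
    intro p hp
    rw [Function.iterate_succ_apply, derivative_restrictLine, Polynomial.iterate_derivative_sum,
      Polynomial.eval_finsetSum]
    refine Finset.sum_eq_zero fun v _ => ?_
    rw [Polynomial.iterate_derivative_C_mul, Polynomial.eval_mul, ih, mul_zero]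
    intro l hl
    simpa [iterDeriv] using hp (l ++ [v]) (by simp [hl])

end Derivatives

section GenericPfaffian

/-- The pairing `(i, 0) ↦ 2i`, `(i, 1) ↦ 2i + 1` of the rows of a matrix of even size. -/
def pairEquiv {n : ℕ} (hn : n / 2 * 2 = n) : Fin (n / 2) × Fin 2 ≃ Fin n :=
  finProdFinEquiv.trans (finCongr hn)

theorem pf_eq_smul_pfSum {R : Type*} [CommRing R] [Algebra ℚ R] {n : ℕ} (hn : n / 2 * 2 = n)
    (Z : Matrix (Fin n) (Fin n) R) :
    pf Z = ((2 ^ (n / 2) * Nat.factorial (n / 2) : ℚ))⁻¹ •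
      pfSum (Z.submatrix (pairEquiv hn) (pairEquiv hn)) := by
  rw [pf, pfSum]
  congr 1
  refine Fintype.sum_equiv (pairEquiv hn).symm.permCongr _ _ fun σ => ?_
  rw [Equiv.Perm.sign_permCongr]
  congr 1
  refine Fintype.prod_congr _ _ fun i => ?_
  have h0 : pairEquiv hn (i, 0) = ⟨2 * i, by have := i.isLt; omega⟩ := by
    ext; simp [pairEquiv]
  have h1 : pairEquiv hn (i, 1) = ⟨2 * i + 1, by have := i.isLt; omega⟩ := by
    ext; simp [pairEquiv, add_comm]
  simp [Equiv.permCongr_apply, h0, h1]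

theorem genMat_map {K S : Type*} [Field K] [CommRing S] {n : ℕ} (Z : Matrix (Fin n) (Fin n) S)
    (hZ : Zᵀ = -Z) (hZ0 : ∀ i, Z i i = 0)
    (f : MvPolynomial {p : Fin n × Fin n // p.1 < p.2} K →+* S)
    (hf : ∀ v, f (MvPolynomial.X v) = Z v.1.1 v.1.2) : (genMat K n).map f = Z := by
  ext i j
  rw [Matrix.map_apply, genMat, Matrix.of_apply]
  split_ifs with h h'
  · exact hf _
  · rw [map_neg, hf]
    have := congrFun (congrFun hZ i) j
    simp only [Matrix.transpose_apply, Matrix.neg_apply] at this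
    simp [this]
  · obtain rfl : i = j := le_antisymm (not_lt.1 h') (not_lt.1 h)
    rw [map_zero, hZ0]

variable {K : Type*} [Field K] [CharZero K] {n : ℕ}

theorem exists_congruent_altBlock_submatrix (hn : n / 2 * 2 = n) (Z : Matrix (Fin n) (Fin n) K)
    (hZ : Zᵀ = -Z) :
    ∃ (s : Finset (Fin (n / 2))) (A : Matrix (Fin (n / 2) × Fin 2) (Fin (n / 2) × Fin 2) K),
      IsUnit A.det ∧ Z.submatrix (pairEquiv hn) (pairEquiv hn) =
        A * altBlock (fun i => if i ∈ s then (1 : K) else 0) * Aᵀ ∧ Z.rank = 2 * s.card := by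
  obtain ⟨s, A, hA, h, hr⟩ := exists_congruent_altBlock
    (Z.submatrix (pairEquiv hn) (pairEquiv hn))
    (by rw [Matrix.transpose_submatrix, hZ]; rfl)
  exact ⟨s, A, hA, h, by rw [← hr, Matrix.rank_submatrix]⟩

theorem pf_genMat_mem_pow (hn : n / 2 * 2 = n) (Z : Matrix (Fin n) (Fin n) K) (hZ : Zᵀ = -Z)
    (hZ0 : ∀ i, Z i i = 0) {h : ℕ} (hr : Z.rank ≤ 2 * h) :
    pf (genMat K n) ∈ RingHom.ker (MvPolynomial.eval
      (fun v : {p : Fin n × Fin n // p.1 < p.2} => Z v.1.1 v.1.2)) ^ (n / 2 - h) := by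
  obtain ⟨s, A, hA, hZA, hs⟩ := exists_congruent_altBlock_submatrix hn Z hZ
  set φ := MvPolynomial.eval (fun v : {p : Fin n × Fin n // p.1 < p.2} => Z v.1.1 v.1.2)
  set G := (genMat K n).submatrix (pairEquiv hn) (pairEquiv hn) with hG
  have hφG : G.map φ = A * altBlock (fun i => if i ∈ s then (1 : K) else 0) * Aᵀ := by
    rw [hG, ← Matrix.submatrix_map, genMat_map Z hZ hZ0 φ (by simp [φ]), hZA]
  let ι : K →+* MvPolynomial {p : Fin n × Fin n // p.1 < p.2} K := MvPolynomial.C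
  let G' := A⁻¹.map ι * G * (A⁻¹.map ι)ᵀ
  have hφι : ∀ M : Matrix (Fin (n / 2) × Fin 2) (Fin (n / 2) × Fin 2) K, (M.map ι).map φ = M :=
    fun M => by ext; simp [ι, φ]
  have hφG' : G'.map φ = altBlock (fun i => if i ∈ s then (1 : K) else 0) := by
    have hT : ((A⁻¹.map ι)ᵀ).map φ = A⁻¹ᵀ := by rw [← Matrix.transpose_map, hφι]
    rw [Matrix.map_mul, Matrix.map_mul, hT, hφι, hφG, Matrix.mul_assoc,
      Matrix.mul_assoc, ← Matrix.transpose_mul, Matrix.nonsing_inv_mul _ hA, Matrix.transpose_one,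
      Matrix.mul_one, ← Matrix.mul_assoc, Matrix.nonsing_inv_mul _ hA, Matrix.one_mul]
  have hG' : G = A.map ι * G' * (A.map ι)ᵀ := by
    have h1 : A.map ι * A⁻¹.map ι = 1 := by
      rw [← Matrix.map_mul, Matrix.mul_nonsing_inv _ hA, Matrix.map_one _ (map_zero _) (map_one _)]
    rw [Matrix.mul_assoc, Matrix.mul_assoc, ← Matrix.transpose_mul, h1, Matrix.transpose_one,
      Matrix.mul_one, ← Matrix.mul_assoc, h1, Matrix.one_mul]
  rw [pf_eq_smul_pfSum hn, ← hG, hG', pfSum_mul_mul_transpose, Algebra.smul_def]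
  refine Ideal.mul_mem_left _ _ (Ideal.mul_mem_left _ _ (Ideal.pow_le_pow_right
    (n := Fintype.card (Fin (n / 2)) - s.card) (by rw [Fintype.card_fin]; omega)
    (pfSum_mem_pow _ s _ fun x y hxy => ?_)))
  rw [RingHom.mem_ker, ← Matrix.map_apply (f := φ), hφG', altBlock_apply]
  by_cases h1 : x.1 = y.1
  · simp [show x.1 ∉ s from fun hs => hxy ⟨h1, hs⟩]
  · rw [if_neg h1]

theorem exists_restrictLine_pf_genMat (hn : n / 2 * 2 = n) (Z : Matrix (Fin n) (Fin n) K)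
    (hZ : Zᵀ = -Z) (hZ0 : ∀ i, Z i i = 0) {h : ℕ} (hr : Z.rank = 2 * h) :
    ∃ (w : {p : Fin n × Fin n // p.1 < p.2} → K) (c : K), c ≠ 0 ∧
      restrictLine (fun v => Z v.1.1 v.1.2) w (pf (genMat K n)) =
        Polynomial.C c * Polynomial.X ^ (n / 2 - h) := by
  obtain ⟨s, A, hA, hZA, hs⟩ := exists_congruent_altBlock_submatrix hn Z hZ
  let d : Fin (n / 2) → K := fun i => if i ∈ s then 0 else 1
  let W : Matrix (Fin n) (Fin n) K :=
    (A * altBlock d * Aᵀ).submatrix (pairEquiv hn).symm (pairEquiv hn).symm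
  have hW : Wᵀ = -W := by
    ext i j
    simp only [W, Matrix.transpose_submatrix, Matrix.transpose_mul, Matrix.transpose_transpose,
      altBlock_transpose, Matrix.mul_assoc]
    simp
  have hW0 : ∀ i, W i i = 0 := fun i => self_eq_neg.1 (congrFun (congrFun hW i) i)
  let w : {p : Fin n × Fin n // p.1 < p.2} → K := fun v => W v.1.1 v.1.2
  let φ : MvPolynomial {p : Fin n × Fin n // p.1 < p.2} K →+* Polynomial K :=
    (restrictLine (fun v => Z v.1.1 v.1.2) w : _ →ₐ[K] Polynomial K)
  let M : Matrix (Fin n) (Fin n) (Polynomial K) :=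
    Matrix.of fun i j => Polynomial.C (Z i j) + Polynomial.X * Polynomial.C (W i j)
  have hφ : (genMat K n).map φ = M := by
    refine genMat_map M ?_ ?_ _ ?_
    · ext1 i j
      have h1 : Z j i = -Z i j := congrFun (congrFun hZ i) j
      have h2 : W j i = -W i j := congrFun (congrFun hW i) j
      simp [M, h1, h2]
      ring
    · simp [M, hZ0, hW0]
    · simp [φ, restrictLine, M, w]
  have hM : M.submatrix (pairEquiv hn) (pairEquiv hn) = A.map Polynomial.C *
      altBlock (fun i => if i ∈ s then 1 else Polynomial.X) * (A.map Polynomial.C)ᵀ := by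
    have hJ : altBlock (fun i => if i ∈ s then 1 else Polynomial.X) =
        (altBlock (fun i => if i ∈ s then (1 : K) else 0)).map Polynomial.C +
          (Polynomial.X : Polynomial K) • (altBlock d).map Polynomial.C := by
      ext1 ⟨i, a⟩ ⟨j, b⟩
      rw [Matrix.add_apply, Matrix.smul_apply, Matrix.map_apply, Matrix.map_apply, altBlock_apply,
        altBlock_apply, altBlock_apply]
      by_cases hij : i = j
      · by_cases hi : i ∈ s <;> fin_cases a <;> fin_cases b <;> simp [d, ← hij, hi]
      · simp [hij]
    have hMe : M.submatrix (pairEquiv hn) (pairEquiv hn) =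
        (Z.submatrix (pairEquiv hn) (pairEquiv hn)).map Polynomial.C +
          (Polynomial.X : Polynomial K) • (A * altBlock d * Aᵀ).map Polynomial.C := by
      ext1 x y
      simp only [M, W, Matrix.submatrix_apply, Matrix.of_apply, Matrix.add_apply, Matrix.smul_apply,
        Matrix.map_apply, Equiv.symm_apply_apply, smul_eq_mul]
    rw [hMe, hZA, hJ, Matrix.mul_add, Matrix.add_mul, Matrix.mul_smul, Matrix.smul_mul]
    simp only [Matrix.map_mul, Matrix.transpose_map]
  refine ⟨w, algebraMap ℚ K ((2 ^ (n / 2) * Nat.factorial (n / 2) : ℚ))⁻¹ *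
    (A.det * pfSum (altBlock (1 : Fin (n / 2) → K))), ?_, ?_⟩
  · refine mul_ne_zero ?_ (mul_ne_zero hA.ne_zero pfSum_altBlock_one_ne_zero)
    rw [map_ne_zero]
    positivity
  · have hdet : (A.map Polynomial.C).det = Polynomial.C A.det := (RingHom.map_det _ _).symm
    have hone : pfSum (altBlock (1 : Fin (n / 2) → Polynomial K)) =
        Polynomial.C (pfSum (altBlock (1 : Fin (n / 2) → K))) := by
      rw [map_pfSum, altBlock_one_map]
    have hprod : ∏ i : Fin (n / 2), (if i ∈ s then 1 else Polynomial.X : Polynomial K) =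
        Polynomial.X ^ (n / 2 - h) := by
      rw [Finset.prod_ite, Finset.prod_const_one, one_mul, Finset.prod_const,
        Finset.filter_not, Finset.filter_mem_eq_inter, Finset.univ_inter,
        ← Finset.compl_eq_univ_sdiff, Finset.card_compl, Fintype.card_fin,
        show s.card = h by omega]
    change φ _ = _
    rw [pf_eq_smul_pfSum hn, Algebra.smul_def, map_mul, RingHom.map_rat_algebraMap, map_pfSum,
      ← Matrix.submatrix_map, hφ, hM, pfSum_mul_mul_transpose, pfSum_altBlock, hdet, hone, hprod,
      map_mul, map_mul, Polynomial.algebraMap_apply]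
    ring

end GenericPfaffian
theorem genericPfaffian_vanishing_order {K : Type*} [Field K] [CharZero K]
    (k h : ℕ) (hhk : h ≤ k) :
    (∀ Z : Matrix (Fin (2 * k + 2)) (Fin (2 * k + 2)) K,
      (Zᵀ = -Z ∧ ∀ i, Z i i = 0) → Z.rank ≤ 2 * h →
      ∀ l : List {p : Fin (2 * k + 2) × Fin (2 * k + 2) // p.1 < p.2},
        l.length ≤ k - h →
        MvPolynomial.eval (fun v => Z v.1.1 v.1.2)
          (iterDeriv l (pf (genMat K (2 * k + 2)))) = 0) ∧
    (∀ Z : Matrix (Fin (2 * k + 2)) (Fin (2 * k + 2)) K,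
      (Zᵀ = -Z ∧ ∀ i, Z i i = 0) → Z.rank = 2 * h →
      ∃ l : List {p : Fin (2 * k + 2) × Fin (2 * k + 2) // p.1 < p.2},
        l.length = k - h + 1 ∧
        MvPolynomial.eval (fun v => Z v.1.1 v.1.2)
          (iterDeriv l (pf (genMat K (2 * k + 2)))) ≠ 0) := by
  have hn : (2 * k + 2) / 2 * 2 = 2 * k + 2 := by omega
  refine ⟨fun Z hZ hr l hl => ?_, fun Z hZ hr => ?_⟩
  · have h1 := pf_genMat_mem_pow hn Z hZ.1 hZ.2 hr
    have h2 := iterDeriv_mem_pow _ 1 l (Ideal.pow_le_pow_right (by omega) h1)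
    rwa [pow_one, RingHom.mem_ker] at h2
  · obtain ⟨w, c, hc, hw⟩ := exists_restrictLine_pf_genMat hn Z hZ.1 hZ.2 hr
    by_contra! H
    have h1 := eval_iterate_derivative_restrictLine_eq_zero _ w (k - h + 1) _ H
    rw [hw, show (2 * k + 2) / 2 - h = k - h + 1 by omega, Polynomial.iterate_derivative_C_mul,
      Polynomial.iterate_derivative_X_pow_eq_smul] at h1
    simp [hc] at h1
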